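/- arXiv:2308.14764 — 5 statements merged into one kernel-verified Lean document; each statement's English description precedes it below -/
import Mathlib

section
/- Let n be a positive integer, let σ > 1 and τ < 1 be real numbers, and let a, b, c ≥ 0. Then every positive solution of the Lichnerowicz type equation Δu + au − bu^σ + cu^τ = 0 on all of ℝⁿ is constant. -/
open Set Metric

/-- Euclidean space ℝⁿ. -/
abbrev E (n : ℕ) := EuclideanSpace ℝ (Fin n)

/-- The Laplacian of `u : ℝⁿ → ℝ`: the sum of its second partial derivatives. -/
noncomputable def lap {n : ℕ} (u : E n → ℝ) (x : E n) : ℝ :=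
  ∑ i : Fin n,
    iteratedFDeriv ℝ 2 u x ![EuclideanSpace.single i 1, EuclideanSpace.single i 1]

open Filter Topology MeasureTheory

lemma IsLocalMax.deriv_deriv_nonpos {p p' : ℝ → ℝ} {p'' t : ℝ} (hmax : IsLocalMax p t)
    (hp : ∀ᶠ s in 𝓝 t, HasDerivAt p (p' s) s) (hp' : HasDerivAt p' p'' t) : p'' ≤ 0 := by
  by_contra! hpos
  have hderiv : deriv p =ᶠ[𝓝 t] p' := hp.mono fun s hs => hs.deriv
  have hdd : deriv (deriv p) t = p'' := by rw [hderiv.deriv_eq, hp'.deriv]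
  have hmin : IsLocalMin p t :=
    isLocalMin_of_deriv_deriv_pos (by rwa [hdd]) hmax.deriv_eq_zero hp.self_of_nhds.continuousAt
  have hconst : p =ᶠ[𝓝 t] fun _ => p t := by
    filter_upwards [hmax, hmin] with s h1 h2 using le_antisymm h1 h2
  have : deriv (deriv p) t = 0 := by
    rw [hconst.deriv.deriv_eq]
    simp
  linarith

section SecondDerivatives

variable {n : ℕ} {u : E n → ℝ}

lemma lap_eq_sum (u : E n → ℝ) (x : E n) :
    lap u x = ∑ i : Fin n, fderiv ℝ (fderiv ℝ u) x (EuclideanSpace.single i 1)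
      (EuclideanSpace.single i 1) := by
  simp [lap, iteratedFDeriv_two_apply]

lemma lap_neg (u : E n → ℝ) (x : E n) : lap (fun y => -u y) x = -lap u x := by
  have h : fderiv ℝ (fun y => -u y) = fun y => -fderiv ℝ u y := by
    ext1 y
    exact fderiv_fun_neg
  simp [lap_eq_sum, h, fderiv_fun_neg]

lemma ContDiff.hasDerivAt_line (hu : ContDiff ℝ 2 u) (x v : E n) (t : ℝ) :
    HasDerivAt (fun s : ℝ => u (x + s • v)) (fderiv ℝ u (x + t • v) v) t := by
  have hl : HasDerivAt (fun s : ℝ => x + s • v) v t := by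
    simpa using ((hasDerivAt_id t).smul_const v).const_add x
  exact ((hu.differentiable (by norm_num)) _).hasFDerivAt.comp_hasDerivAt t hl

lemma ContDiff.hasFDerivAt_fderiv_apply (hu : ContDiff ℝ 2 u) (x v : E n) :
    HasFDerivAt (fun y => fderiv ℝ u y v) ((fderiv ℝ (fderiv ℝ u) x).flip v) x := by
  have h1 : ContDiff ℝ 1 (fderiv ℝ u) := hu.fderiv_right (by norm_num)
  have h := ((h1.differentiable (by norm_num)) x).hasFDerivAt.clm_apply (hasFDerivAt_const v x)
  simpa using h

lemma ContDiff.hasDerivAt_fderiv_line (hu : ContDiff ℝ 2 u) (x v : E n) (t : ℝ) :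
    HasDerivAt (fun s : ℝ => fderiv ℝ u (x + s • v) v)
      (fderiv ℝ (fderiv ℝ u) (x + t • v) v v) t := by
  have hl : HasDerivAt (fun s : ℝ => x + s • v) v t := by
    simpa using ((hasDerivAt_id t).smul_const v).const_add x
  exact (hu.hasFDerivAt_fderiv_apply (x + t • v) v).comp_hasDerivAt t hl

lemma norm_sq_add_smul_single (x : E n) (i : Fin n) (t : ℝ) :
    ‖x + t • EuclideanSpace.single i (1 : ℝ)‖ ^ 2 = ‖x‖ ^ 2 + 2 * t * x i + t ^ 2 := by
  rw [norm_add_sq_real, inner_smul_right, EuclideanSpace.inner_single_right, norm_smul]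
  simp
  ring

/-- Comparison with `(R² - |x - x₀|²) ^ β` at a point of contact. -/
lemma lap_le_of_le_rpow (hu : ContDiff ℝ 2 u) {x₀ x : E n} {R β : ℝ}
    (hx : 0 < R ^ 2 - ‖x - x₀‖ ^ 2)
    (hle : ∀ y, 0 < R ^ 2 - ‖y - x₀‖ ^ 2 →
      u y ≤ u x * (R ^ 2 - ‖x - x₀‖ ^ 2) ^ (-β) * (R ^ 2 - ‖y - x₀‖ ^ 2) ^ β) :
    lap u x ≤ u x * (4 * β * (β - 1) * ‖x - x₀‖ ^ 2 / (R ^ 2 - ‖x - x₀‖ ^ 2) ^ 2 -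
      2 * n * β / (R ^ 2 - ‖x - x₀‖ ^ 2)) := by
  set ρ := R ^ 2 - ‖x - x₀‖ ^ 2 with hρ
  set M := u x * ρ ^ (-β) with hM
  have hMρ : M * ρ ^ β = u x := by
    rw [hM, mul_assoc, ← Real.rpow_add hx]; simp
  have key : ∀ i : Fin n, fderiv ℝ (fderiv ℝ u) x (EuclideanSpace.single i 1)
      (EuclideanSpace.single i 1) ≤
      u x * (4 * β * (β - 1) / ρ ^ 2 * (x - x₀) i ^ 2 - 2 * β / ρ) := by
    intro i
    set v : E n := EuclideanSpace.single i 1 with hv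
    set p := (x - x₀) i
    let q : ℝ → ℝ := fun t => ρ - 2 * t * p - t ^ 2
    have hq : ∀ t, R ^ 2 - ‖x + t • v - x₀‖ ^ 2 = q t := by
      intro t
      have : x + t • v - x₀ = (x - x₀) + t • v := by abel
      rw [this, hv, norm_sq_add_smul_single]
      simp only [q, hρ, p]
      ring
    have hq0 : q 0 = ρ := by simp [q]
    have hqc : Continuous q := by fun_prop
    have hqpos : ∀ᶠ t in 𝓝 (0 : ℝ), 0 < q t :=
      hqc.continuousAt.eventually (lt_mem_nhds (by rw [hq0]; exact hx))
    have hqd : ∀ t, HasDerivAt q (-2 * p - 2 * t) t := by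
      intro t
      have h := (((hasDerivAt_id t).const_mul 2).mul_const p).const_sub ρ |>.sub
        ((hasDerivAt_id t).pow 2)
      refine (h.congr_deriv ?_).congr_of_eventuallyEq (Eventually.of_forall fun s => ?_)
      · simp
      · simp [q]
    have hmax : IsLocalMax (fun t => u (x + t • v) - M * q t ^ β) 0 := by
      filter_upwards [hqpos] with t ht
      have h1 := hle (x + t • v) (by rw [hq]; exact ht)
      rw [hq] at h1
      simp only [zero_smul, add_zero, hq0, hMρ]
      linarith
    have hd1 : ∀ᶠ t in 𝓝 (0 : ℝ), HasDerivAt (fun t => u (x + t • v) - M * q t ^ β)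
        (fderiv ℝ u (x + t • v) v - M * ((-2 * p - 2 * t) * β * q t ^ (β - 1))) t := by
      filter_upwards [hqpos] with t ht
      exact (hu.hasDerivAt_line x v t).sub
        (((hqd t).rpow_const (Or.inl ht.ne')).const_mul M)
    have hd2 : HasDerivAt
        (fun t => fderiv ℝ u (x + t • v) v - M * ((-2 * p - 2 * t) * β * q t ^ (β - 1)))
        (fderiv ℝ (fderiv ℝ u) x v v -
          M * (-2 * β * ρ ^ (β - 1) + (-2 * p) * β * ((-2 * p) * (β - 1) * ρ ^ (β - 1 - 1)))) 0 := by
      have h1 := hu.hasDerivAt_fderiv_line x v 0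
      have h2 : HasDerivAt (fun t : ℝ => (-2 * p - 2 * t) * β) (-2 * β) 0 := by
        have := (((hasDerivAt_id (0 : ℝ)).const_mul 2).const_sub (-2 * p)).mul_const β
        simpa using this
      have h3 := (hqd 0).rpow_const (p := β - 1) (Or.inl (by rw [hq0]; exact hx.ne'))
      have h4 := h1.sub ((h2.mul h3).const_mul M)
      refine h4.congr_deriv ?_
      simp [hq0]
    have h := hmax.deriv_deriv_nonpos hd1 hd2
    rw [Real.rpow_sub hx (β - 1), Real.rpow_sub hx β, Real.rpow_one] at h
    have e : u x * (4 * β * (β - 1) / ρ ^ 2 * p ^ 2 - 2 * β / ρ) =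
        M * (-2 * β * (ρ ^ β / ρ) + (-2 * p) * β * ((-2 * p) * (β - 1) * (ρ ^ β / ρ / ρ))) := by
      rw [← hMρ]
      field_simp
      ring
    linarith
  rw [lap_eq_sum]
  refine (Finset.sum_le_sum fun i _ => key i).trans_eq ?_
  rw [← Finset.mul_sum, Finset.sum_sub_distrib, ← Finset.mul_sum,
    ← EuclideanSpace.real_norm_sq_eq]
  simp
  left
  ring

/-- A positive continuous function weighted by a power of `R² - |y - x₀|²` attains its maximum
inside the ball. -/
lemma exists_max_weighted {v : E n → ℝ} (hv : Continuous v) (hpos : ∀ x, 0 < v x) (x₀ : E n)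
    {R α : ℝ} (hR : 0 < R) (hα : 0 < α) :
    ∃ x, 0 < R ^ 2 - ‖x - x₀‖ ^ 2 ∧ ∀ y, 0 < R ^ 2 - ‖y - x₀‖ ^ 2 →
      v y * (R ^ 2 - ‖y - x₀‖ ^ 2) ^ α ≤ v x * (R ^ 2 - ‖x - x₀‖ ^ 2) ^ α := by
  have hc : Continuous fun y => v y * (R ^ 2 - ‖y - x₀‖ ^ 2) ^ α :=
    hv.mul ((by fun_prop : Continuous fun y : E n => R ^ 2 - ‖y - x₀‖ ^ 2).rpow_const
      fun _ => Or.inr hα.le)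
  obtain ⟨x, hx, hmax⟩ := (isCompact_closedBall x₀ R).exists_isMaxOn
    ⟨x₀, mem_closedBall_self hR.le⟩ hc.continuousOn
  have hx' : 0 ≤ R ^ 2 - ‖x - x₀‖ ^ 2 := by
    rw [mem_closedBall, dist_eq_norm] at hx
    have := pow_le_pow_left₀ (norm_nonneg _) hx 2
    linarith
  refine ⟨x, lt_of_le_of_ne hx' fun h0 => ?_, fun y hy => hmax ?_⟩
  · have h := hmax (mem_closedBall_self hR.le : x₀ ∈ closedBall x₀ R)
    simp only [mem_ofPred_eq, ← h0, Real.zero_rpow hα.ne', mul_zero, sub_self, norm_zero] at h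
    have : 0 < v x₀ * (R ^ 2 - 0 ^ 2) ^ α :=
      mul_pos (hpos x₀) (Real.rpow_pos_of_pos (by nlinarith) _)
    linarith
  · rw [mem_closedBall, dist_eq_norm]
    exact (sq_le_sq₀ (norm_nonneg _) hR.le).1 (by linarith)

end SecondDerivatives

section MeanValue

lemma hasDerivAt_sq_max_zero (s : ℝ) :
    HasDerivAt (fun t : ℝ => max t 0 ^ 2) (2 * max s 0) s := by
  rcases lt_trichotomy s 0 with hs | rfl | hs
  · have h : (fun t : ℝ => max t 0 ^ 2) =ᶠ[𝓝 s] fun _ => 0 := by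
      filter_upwards [gt_mem_nhds hs] with t ht
      simp [max_eq_right ht.le]
    rw [max_eq_right hs.le, mul_zero]
    exact (hasDerivAt_const s (0 : ℝ)).congr_of_eventuallyEq h
  · rw [hasDerivAt_iff_isLittleO]
    have h : (fun t : ℝ => t ^ 2) =o[𝓝 0] fun t : ℝ => t := Asymptotics.isLittleO_pow_id one_lt_two
    have h2 : (fun t : ℝ => max t 0 ^ 2) =O[𝓝 0] fun t : ℝ => t ^ 2 := by
      refine Asymptotics.IsBigO.of_bound 1 (Eventually.of_forall fun t => ?_)
      rcases le_total t 0 with ht | ht <;> simp [ht, sq_nonneg]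
    simpa using h2.trans_isLittleO h
  · have h : (fun t : ℝ => max t 0 ^ 2) =ᶠ[𝓝 s] fun t => t ^ 2 := by
      filter_upwards [lt_mem_nhds hs] with t ht
      simp [max_eq_left ht.le]
    rw [max_eq_left hs.le]
    simpa using (hasDerivAt_pow 2 s).congr_of_eventuallyEq h

variable {n : ℕ} {u : E n → ℝ}

/-- The paraboloid kernel supported in the closed unit ball. -/
noncomputable def paraboloid (y : E n) : ℝ := max (1 - ‖y‖ ^ 2) 0

lemma continuous_paraboloid : Continuous (paraboloid (n := n)) := by
  unfold paraboloid; fun_prop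

lemma paraboloid_eq_zero {y : E n} (hy : y ∉ closedBall (0 : E n) 1) : paraboloid y = 0 := by
  rw [mem_closedBall, dist_zero_right, not_le] at hy
  exact max_eq_right (by nlinarith)

lemma hasCompactSupport_paraboloid : HasCompactSupport (paraboloid (n := n)) :=
  HasCompactSupport.intro (isCompact_closedBall 0 1) fun _ => paraboloid_eq_zero

lemma integrable_mul_paraboloid {f : E n → ℝ} (hf : Continuous f) :
    Integrable fun y => f y * paraboloid y :=
  (hf.mul continuous_paraboloid).integrable_of_hasCompactSupport
    hasCompactSupport_paraboloid.mul_left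

lemma integral_paraboloid_pos : 0 < ∫ y : E n, paraboloid y :=
  continuous_paraboloid.integral_pos_of_hasCompactSupport_nonneg_nonzero
    hasCompactSupport_paraboloid (fun _ => le_max_right _ _) (x := 0) (by simp [paraboloid])

lemma hasFDerivAt_paraboloid_sq (y : E n) :
    HasFDerivAt (fun y : E n => paraboloid y ^ 2) ((-4 * paraboloid y) • innerSL ℝ y) y := by
  have h1 : HasFDerivAt (fun y : E n => 1 - ‖y‖ ^ 2) (-(2 • innerSL ℝ y)) y :=
    (hasStrictFDerivAt_norm_sq y).hasFDerivAt.const_sub 1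
  have h2 := (hasDerivAt_sq_max_zero (1 - ‖y‖ ^ 2)).comp_hasFDerivAt y h1
  refine h2.congr_fderiv ?_
  ext v
  simp [paraboloid]
  ring

lemma integral_fderiv_mul_paraboloid (hu : ContDiff ℝ 2 u) (hharm : ∀ x, lap u x = 0)
    (x : E n) (R : ℝ) : ∫ y, fderiv ℝ u (x + R • y) y * paraboloid y = 0 := by
  have h1 : ContDiff ℝ 1 (fderiv ℝ u) := hu.fderiv_right (by norm_num)
  have hDu : Continuous (fderiv ℝ u) := h1.continuous
  have hD2u : Continuous (fderiv ℝ (fderiv ℝ u)) := h1.continuous_fderiv (by norm_num)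
  have hcp := continuous_paraboloid (n := n)
  let e : Fin n → E n := fun i => EuclideanSpace.single i 1
  have hfd : ∀ (i : Fin n) (y : E n), HasFDerivAt (fun y => fderiv ℝ u (x + R • y) (e i))
      (((fderiv ℝ (fderiv ℝ u) (x + R • y)).flip (e i)).comp
        (R • ContinuousLinearMap.id ℝ (E n))) y := by
    intro i y
    have hl : HasFDerivAt (fun y : E n => x + R • y) (R • ContinuousLinearMap.id ℝ (E n)) y :=
      ((hasFDerivAt_id y).const_smul R).const_add x
    exact HasFDerivAt.comp y (hu.hasFDerivAt_fderiv_apply (x + R • y) (e i)) hl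
  have hfde : ∀ (i : Fin n) (y : E n), fderiv ℝ (fun y => fderiv ℝ u (x + R • y) (e i)) y (e i) =
      R * fderiv ℝ (fderiv ℝ u) (x + R • y) (e i) (e i) := by
    intro i y
    rw [(hfd i y).fderiv]
    simp
  have hge : ∀ (i : Fin n) (y : E n), fderiv ℝ (fun y : E n => paraboloid y ^ 2) y (e i) =
      -4 * y i * paraboloid y := by
    intro i y
    rw [(hasFDerivAt_paraboloid_sq y).fderiv]
    simp [e, EuclideanSpace.inner_single_right]
    ring
  have hparts : ∀ i : Fin n, ∫ y, fderiv ℝ u (x + R • y) (e i) * (-4 * y i * paraboloid y) =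
      -∫ y, R * fderiv ℝ (fderiv ℝ u) (x + R • y) (e i) (e i) * paraboloid y ^ 2 := by
    intro i
    have h := integral_mul_fderiv_eq_neg_fderiv_mul_of_integrable (μ := volume)
      (f := fun y => fderiv ℝ u (x + R • y) (e i)) (g := fun y : E n => paraboloid y ^ 2)
      (v := e i) ?_ ?_ ?_ (fun y _ => (hfd i y).differentiableAt)
      (fun y _ => (hasFDerivAt_paraboloid_sq y).differentiableAt)
    · simpa only [hfde, hge] using h
    · simp only [hfde, pow_two, ← mul_assoc]
      exact integrable_mul_paraboloid (by fun_prop)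
    · simp only [hge, ← mul_assoc]
      exact integrable_mul_paraboloid (by fun_prop)
    · simp only [pow_two, ← mul_assoc]
      exact integrable_mul_paraboloid (by fun_prop)
  have hsum : ∫ y, ∑ i, fderiv ℝ u (x + R • y) (e i) * (-4 * y i * paraboloid y) =
      -∫ y, ∑ i, R * fderiv ℝ (fderiv ℝ u) (x + R • y) (e i) (e i) * paraboloid y ^ 2 := by
    rw [integral_finsetSum, integral_finsetSum, ← Finset.sum_neg_distrib]
    · exact Finset.sum_congr rfl fun i _ => hparts i
    · intro i _
      simp only [pow_two, ← mul_assoc]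
      exact integrable_mul_paraboloid (by fun_prop)
    · intro i _
      simp only [← mul_assoc]
      exact integrable_mul_paraboloid (by fun_prop)
  have hright : ∀ y, ∑ i, R * fderiv ℝ (fderiv ℝ u) (x + R • y) (e i) (e i) * paraboloid y ^ 2 =
      0 := by
    intro y
    rw [← Finset.sum_mul, ← Finset.mul_sum, ← lap_eq_sum, hharm]
    simp
  have hleft : ∀ y, ∑ i, fderiv ℝ u (x + R • y) (e i) * (-4 * y i * paraboloid y) =
      -4 * (fderiv ℝ u (x + R • y) y * paraboloid y) := by
    intro y
    have hy : fderiv ℝ u (x + R • y) y = ∑ i, y i * fderiv ℝ u (x + R • y) (e i) := by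
      have h := congrArg (fderiv ℝ u (x + R • y)) ((EuclideanSpace.basisFun (Fin n) ℝ).sum_repr y)
      rw [map_sum] at h
      simpa [e] using h.symm
    rw [hy, Finset.sum_mul, Finset.mul_sum]
    exact Finset.sum_congr rfl fun i _ => by ring
  simp only [hright, hleft, integral_zero, neg_zero, integral_const_mul] at hsum
  linarith

/-- Weighted mean value property of harmonic functions. -/
lemma integral_mul_paraboloid_eq (hu : ContDiff ℝ 2 u) (hharm : ∀ x, lap u x = 0)
    (x : E n) (R : ℝ) :
    ∫ y, u (x + R • y) * paraboloid y = u x * ∫ y : E n, paraboloid y := by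
  have hcu : Continuous u := hu.continuous
  have hDu : Continuous (fderiv ℝ u) := hu.continuous_fderiv (by norm_num)
  have hcp := continuous_paraboloid (n := n)
  have hderiv : ∀ r : ℝ, HasDerivAt (fun r : ℝ => ∫ y, u (x + r • y) * paraboloid y) 0 r := by
    intro r
    have hc : Continuous fun q : ℝ × E n => fderiv ℝ u (x + q.1 • q.2) q.2 * paraboloid q.2 := by
      fun_prop
    obtain ⟨C, hC⟩ := ((isCompact_closedBall r 1).prod
      (isCompact_closedBall (0 : E n) 1)).exists_bound_of_continuousOn hc.continuousOn
    rw [← integral_fderiv_mul_paraboloid hu hharm x r]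
    refine (hasDerivAt_integral_of_dominated_loc_of_deriv_le
      (F := fun r y => u (x + r • y) * paraboloid y)
      (F' := fun r y => fderiv ℝ u (x + r • y) y * paraboloid y)
      (bound := (closedBall (0 : E n) 1).indicator fun _ => C)
      (closedBall_mem_nhds r one_pos) ?_ ?_ ?_ ?_ ?_ ?_).2
    · exact Eventually.of_forall fun r =>
        (by fun_prop : Continuous fun y => u (x + r • y) * paraboloid y).aestronglyMeasurable
    · exact integrable_mul_paraboloid (by fun_prop)
    · exact (by fun_prop : Continuous
        fun y => fderiv ℝ u (x + r • y) y * paraboloid y).aestronglyMeasurable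
    · refine Eventually.of_forall fun y s hs => ?_
      by_cases hy : y ∈ closedBall (0 : E n) 1
      · rw [indicator_of_mem hy]
        exact hC (s, y) ⟨hs, hy⟩
      · rw [indicator_of_notMem hy, paraboloid_eq_zero hy]
        simp
    · exact (integrable_indicator_iff measurableSet_closedBall).2
        (integrableOn_const (measure_closedBall_lt_top.ne))
    · exact Eventually.of_forall fun y s _ => (hu.hasDerivAt_line x y s).mul_const _
  have h := is_const_of_deriv_eq_zero (fun r => (hderiv r).differentiableAt)
    (fun r => (hderiv r).deriv) R 0
  simpa [integral_const_mul] using h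

lemma integral_mul_max_eq (hu : ContDiff ℝ 2 u) (hharm : ∀ x, lap u x = 0)
    (x : E n) {R : ℝ} (hR : 0 < R) :
    ∫ z, u z * max (R ^ 2 - ‖z - x‖ ^ 2) 0 = R ^ (n + 2) * (u x * ∫ y : E n, paraboloid y) := by
  have h1 : ∀ z : E n, max (R ^ 2 - ‖z‖ ^ 2) 0 = R ^ 2 * paraboloid (R⁻¹ • z) := by
    intro z
    rw [paraboloid, mul_max_of_nonneg _ _ (sq_nonneg R), mul_zero, norm_smul, norm_inv,
      Real.norm_eq_abs, abs_of_pos hR]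
    congr 1
    field_simp
  have h2 := Measure.integral_comp_inv_smul_of_nonneg (volume : Measure (E n))
    (fun y : E n => u (x + R • y) * paraboloid y) hR.le
  rw [integral_mul_paraboloid_eq hu hharm, finrank_euclideanSpace_fin] at h2
  rw [← integral_add_right_eq_self _ x]
  calc ∫ z, u (z + x) * max (R ^ 2 - ‖z + x - x‖ ^ 2) 0
      = ∫ z, R ^ 2 * (u (x + R • (R⁻¹ • z)) * paraboloid (R⁻¹ • z)) := by
        congr 1
        ext z
        rw [add_sub_cancel_right, h1, smul_inv_smul₀ hR.ne', add_comm z x]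
        ring
    _ = _ := by
        rw [integral_const_mul, h2, smul_eq_mul]
        ring

/-- Liouville theorem for positive harmonic functions. -/
lemma harmonic_le_of_pos (hu : ContDiff ℝ 2 u) (hharm : ∀ x, lap u x = 0)
    (hpos : ∀ x, 0 < u x) (x y : E n) : u x ≤ u y := by
  have hcu : Continuous u := hu.continuous
  set d := ‖x - y‖
  have hd : 0 ≤ d := norm_nonneg _
  have hInt : ∀ (x : E n) (R : ℝ), Integrable fun z => u z * max (R ^ 2 - ‖z - x‖ ^ 2) 0 := by
    intro x R
    refine Continuous.integrable_of_hasCompactSupport (by fun_prop)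
      (HasCompactSupport.intro (isCompact_closedBall x |R|) fun z hz => ?_)
    rw [mem_closedBall, dist_eq_norm, not_le] at hz
    rw [max_eq_right, mul_zero]
    have := sq_lt_sq' (by linarith [abs_nonneg R]) hz
    rw [sq_abs] at this
    linarith
  have hR : ∀ R : ℝ, 0 < R → u x ≤ (1 + d / R) ^ (n + 2) * u y := by
    intro R hR
    have hmono : ∫ z, u z * max (R ^ 2 - ‖z - x‖ ^ 2) 0 ≤
        ∫ z, u z * max ((R + d) ^ 2 - ‖z - y‖ ^ 2) 0 := by
      refine integral_mono (hInt x R) (hInt y (R + d)) fun z => ?_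
      refine mul_le_mul_of_nonneg_left (max_le ?_ (le_max_right _ _)) (hpos z).le
      rcases le_total R ‖z - x‖ with h | h
      · exact le_max_of_le_right (by nlinarith)
      · refine le_max_of_le_left ?_
        have h3 : ‖z - y‖ ≤ ‖z - x‖ + d := norm_sub_le_norm_sub_add_norm_sub z x y
        nlinarith [norm_nonneg (z - y), norm_nonneg (z - x)]
    rw [integral_mul_max_eq hu hharm x hR, integral_mul_max_eq hu hharm y (by linarith),
      ← mul_assoc, ← mul_assoc] at hmono
    have h4 := le_of_mul_le_mul_right hmono integral_paraboloid_pos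
    have h5 : (1 + d / R) ^ (n + 2) = (R + d) ^ (n + 2) / R ^ (n + 2) := by
      rw [← div_pow]
      congr 1
      field_simp
    rw [h5, div_mul_eq_mul_div, le_div_iff₀ (by positivity)]
    linarith
  have hlim : Tendsto (fun R : ℝ => (1 + d / R) ^ (n + 2) * u y) atTop (𝓝 (u y)) := by
    have := (((tendsto_const_nhds (x := d)).div_atTop tendsto_id).const_add 1).pow (n + 2)
      |>.mul_const (u y)
    simpa using this
  exact ge_of_tendsto hlim ((eventually_gt_atTop 0).mono hR)

end MeanValue

section Semilinear

variable {n : ℕ} {u : E n → ℝ} {g : ℝ → ℝ}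

/-- Positive entire solutions of `Δu = u g(u)` with `g` increasing are subharmonic. -/
lemma lap_eq_mul_nonneg (hu : ContDiff ℝ 2 u) (hpos : ∀ x, 0 < u x)
    (hlap : ∀ x, lap u x = u x * g (u x)) (hg : MonotoneOn g (Ioi 0)) (x₀ : E n) :
    0 ≤ g (u x₀) := by
  set α : ℝ := n + 1
  have hα : 0 < α := by positivity
  have hR : ∀ R : ℝ, 0 < R → -(4 * n * α / R ^ 2) ≤ g (u x₀) := by
    intro R hR
    obtain ⟨x, hx, hmax⟩ := exists_max_weighted (v := fun y => (u y)⁻¹)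
      (hu.continuous.inv₀ fun y => (hpos y).ne') (fun y => inv_pos.2 (hpos y)) x₀ hR hα
    have hle : u x ≤ u x₀ := by
      have h := hmax x₀ (by simp; positivity)
      have h2 : (R ^ 2 - ‖x - x₀‖ ^ 2) ^ α ≤ (R ^ 2) ^ α :=
        Real.rpow_le_rpow hx.le (by nlinarith [sq_nonneg ‖x - x₀‖]) hα.le
      simp only [sub_self, norm_zero, ne_eq, OfNat.ofNat_ne_zero, not_false_eq_true, zero_pow,
        sub_zero] at h
      have h3 := h.trans (mul_le_mul_of_nonneg_left h2 (inv_pos.2 (hpos x)).le)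
      exact (inv_le_inv₀ (hpos x₀) (hpos x)).1
        (le_of_mul_le_mul_right h3 (Real.rpow_pos_of_pos (by positivity) _))
    refine le_trans ?_ (hg (hpos x) (hpos x₀) hle)
    have h := lap_le_of_le_rpow hu.neg hx (β := α) fun y hy => by
      have h := hmax y hy
      have hρ := Real.rpow_pos_of_pos hx α
      rw [inv_mul_eq_div, inv_mul_eq_div, div_le_div_iff₀ (hpos y) (hpos x)] at h
      rw [Real.rpow_neg hx.le]
      rw [neg_mul, neg_mul, neg_le_neg_iff, mul_right_comm, ← div_eq_mul_inv, div_le_iff₀ hρ]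
      linarith
    rw [lap_neg, hlap, neg_mul, neg_le_neg_iff] at h
    refine le_trans ?_ (le_of_mul_le_mul_left h (hpos x))
    have hα1 : α - 1 = n := by simp [α]
    rw [hα1]
    set ρ := R ^ 2 - ‖x - x₀‖ ^ 2 with hρ
    have hr : ‖x - x₀‖ ^ 2 = R ^ 2 - ρ := by rw [hρ]; ring
    rw [hr, ← sub_nonneg]
    have e : 4 * α * n * (R ^ 2 - ρ) / ρ ^ 2 - 2 * n * α / ρ - -(4 * n * α / R ^ 2) =
        2 * n * α * (2 * (R ^ 2 - 3 / 4 * ρ) ^ 2 + 7 / 8 * ρ ^ 2) / (ρ ^ 2 * R ^ 2) := by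
      field_simp
      ring
    rw [e]
    positivity
  have hlim : Tendsto (fun R : ℝ => -(4 * n * α / R ^ 2)) atTop (𝓝 0) := by
    simpa using ((tendsto_const_nhds (x := 4 * n * α)).div_atTop
      (tendsto_pow_atTop (α := ℝ) two_ne_zero)).neg
  exact le_of_tendsto hlim ((eventually_gt_atTop 0).mono hR)

/-- A Keller–Osserman type estimate: positive entire solutions of `Δu = u g(u)` are superharmonic
when `g` grows at least like a positive power wherever it is positive. -/
lemma lap_eq_mul_nonpos (hu : ContDiff ℝ 2 u) (hpos : ∀ x, 0 < u x)
    (hlap : ∀ x, lap u x = u x * g (u x)) {κ : ℝ} (hκ : 0 < κ)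
    (hg : ∀ s t : ℝ, 0 < s → 1 ≤ t → t ^ κ * g s ≤ g (t * s)) (x₀ : E n) :
    g (u x₀) ≤ 0 := by
  set α : ℝ := 2 / κ
  have hα : 0 < α := by positivity
  have hακ : α * κ = 2 := div_mul_cancel₀ _ hκ.ne'
  by_contra! hη
  have hR : ∀ R : ℝ, 0 < R → g (u x₀) ≤ (4 * α * (α + 1) + 2 * n * α) / R ^ 2 := by
    intro R hR
    obtain ⟨x, hx, hmax⟩ := exists_max_weighted hu.continuous hpos x₀ hR hα
    have h := lap_le_of_le_rpow hu hx (β := -α) fun y hy => by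
      have h := hmax y hy
      rw [neg_neg, Real.rpow_neg hy.le, ← div_eq_mul_inv,
        le_div_iff₀ (Real.rpow_pos_of_pos hy α)]
      exact h
    rw [hlap] at h
    have h := le_of_mul_le_mul_left h (hpos x)
    have h0 := hmax x₀ (by simp; positivity)
    simp only [sub_self, norm_zero, ne_eq, OfNat.ofNat_ne_zero, not_false_eq_true, zero_pow,
      sub_zero] at h0
    set ρ := R ^ 2 - ‖x - x₀‖ ^ 2 with hρ
    have hr : ‖x - x₀‖ ^ 2 = R ^ 2 - ρ := by rw [hρ]; ring
    have hρR : ρ ≤ R ^ 2 := by nlinarith [sq_nonneg ‖x - x₀‖]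
    set t := u x / u x₀ with ht
    have ht0 : 0 < t := div_pos (hpos x) (hpos x₀)
    have h1 : (R ^ 2) ^ α ≤ t * ρ ^ α := by
      rw [ht, div_mul_eq_mul_div, le_div_iff₀ (hpos x₀)]
      linarith
    have ht1 : 1 ≤ t := by
      have h2 : ρ ^ α ≤ (R ^ 2) ^ α := Real.rpow_le_rpow hx.le hρR hα.le
      exact le_of_mul_le_mul_right (by linarith) (Real.rpow_pos_of_pos hx α)
    have h2 : (R ^ 2) ^ 2 ≤ t ^ κ * ρ ^ 2 := by
      have h3 := Real.rpow_le_rpow (by positivity) h1 hκ.le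
      rw [Real.mul_rpow ht0.le (by positivity), ← Real.rpow_mul (by positivity),
        ← Real.rpow_mul hx.le, hακ] at h3
      exact_mod_cast h3
    have h3 := hg (u x₀) t (hpos x₀) ht1
    rw [ht, div_mul_cancel₀ _ (hpos x₀).ne', ← ht] at h3
    have h4 : t ^ κ * ρ ^ 2 * g (u x₀) ≤ 4 * α * (α + 1) * (R ^ 2 - ρ) + 2 * n * α * ρ := by
      have h5 := mul_le_mul_of_nonneg_right (h3.trans h) (sq_nonneg ρ)
      have e : (4 * -α * (-α - 1) * ‖x - x₀‖ ^ 2 / ρ ^ 2 - 2 * n * -α / ρ) * ρ ^ 2 =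
          4 * α * (α + 1) * (R ^ 2 - ρ) + 2 * n * α * ρ := by
        rw [hr]
        field_simp
        ring
      linarith
    have h5 := mul_le_mul_of_nonneg_right h2 hη.le
    have h6 : 4 * α * (α + 1) * (R ^ 2 - ρ) ≤ 4 * α * (α + 1) * R ^ 2 :=
      mul_le_mul_of_nonneg_left (by linarith) (by positivity)
    have h7 : 2 * n * α * ρ ≤ 2 * n * α * R ^ 2 :=
      mul_le_mul_of_nonneg_left hρR (by positivity)
    rw [le_div_iff₀ (by positivity)]
    refine le_of_mul_le_mul_right ?_ (by positivity : 0 < R ^ 2)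
    linarith
  have hlim : Tendsto (fun R : ℝ => (4 * α * (α + 1) + 2 * n * α) / R ^ 2) atTop (𝓝 0) :=
    tendsto_const_nhds.div_atTop (tendsto_pow_atTop two_ne_zero)
  exact hη.not_ge (ge_of_tendsto hlim ((eventually_gt_atTop 0).mono hR))

end Semilinear

/-- Liouville theorem for the Lichnerowicz type equation
`Δu + au - bu^σ + cu^τ = 0` on all of ℝⁿ. -/
theorem stmt13 (n : ℕ) (hn : 0 < n) (σ τ a b c : ℝ)
    (hσ : 1 < σ) (hτ : τ < 1) (ha : 0 ≤ a) (hb : 0 ≤ b) (hc : 0 ≤ c)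
    (u : E n → ℝ) (hu : ContDiff ℝ 2 u) (hupos : ∀ x, 0 < u x)
    (heq : ∀ x, lap u x + a * u x - b * u x ^ σ + c * u x ^ τ = 0) :
    ∀ x y : E n, u x = u y := by
  let g : ℝ → ℝ := fun s => b * s ^ (σ - 1) - a - c * s ^ (τ - 1)
  have hlap : ∀ x, lap u x = u x * g (u x) := by
    intro x
    have hx := hupos x
    have h := heq x
    simp only [g]
    rw [Real.rpow_sub_one hx.ne', Real.rpow_sub_one hx.ne']
    field_simp
    linarith
  have hmono : MonotoneOn g (Ioi 0) := by
    intro s hs t _ hst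
    have h1 : s ^ (σ - 1) ≤ t ^ (σ - 1) := Real.rpow_le_rpow (le_of_lt hs) hst (by linarith)
    have h2 : t ^ (τ - 1) ≤ s ^ (τ - 1) := Real.rpow_le_rpow_of_nonpos hs hst (by linarith)
    have h3 := mul_le_mul_of_nonneg_left h1 hb
    have h4 := mul_le_mul_of_nonneg_left h2 hc
    simp only [g]
    linarith
  have hscale : ∀ s t : ℝ, 0 < s → 1 ≤ t → t ^ (σ - 1) * g s ≤ g (t * s) := by
    intro s t hs ht
    have ht0 : 0 < t := by linarith
    have h1 : 1 ≤ t ^ (σ - 1) := Real.one_le_rpow ht (by linarith)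
    have h2 : t ^ (τ - 1) ≤ t ^ (σ - 1) := Real.rpow_le_rpow_of_exponent_le ht (by linarith)
    have h3 := mul_le_mul_of_nonneg_right h2 (mul_nonneg hc (Real.rpow_nonneg hs.le (τ - 1)))
    have h4 := mul_le_mul_of_nonneg_right h1 ha
    simp only [g]
    rw [Real.mul_rpow ht0.le hs.le, Real.mul_rpow ht0.le hs.le]
    linarith
  have hg : ∀ x, g (u x) = 0 := fun x =>
    le_antisymm (lap_eq_mul_nonpos hu hupos hlap (sub_pos.2 hσ) hscale x)
      (lap_eq_mul_nonneg hu hupos hlap hmono x)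
  have hharm : ∀ x, lap u x = 0 := fun x => by rw [hlap, hg, mul_zero]
  exact fun x y => le_antisymm (harmonic_le_of_pos hu hharm hupos x y)
    (harmonic_le_of_pos hu hharm hupos y x)
end

section
/- Let n be a positive integer, α > 1, μ > 0, and set Γ = (1/2)(n − 2 − 4/(α−1)). Define f : ℝⁿ → ℝ by f(x) = Γ · ln(μ² + |x|²) and u : ℝⁿ → ℝ by u(x) = ( √(4n/(α−1)) · μ/(μ² + |x|²) )^{2/(α−1)}. Then u is positive and smooth and satisfies the drift Lane–Emden equation Δu(x) − ⟨∇f(x), ∇u(x)⟩ + u(x)^α = 0 for every x ∈ ℝⁿ. -/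
open Set Metric

theorem hasFDerivAt_const_mul_rpow_add_norm_sq {F : Type*} [NormedAddCommGroup F]
    [InnerProductSpace ℝ F] {a : ℝ} (ha : 0 < a) (c q : ℝ) (x : F) :
    HasFDerivAt (fun y : F => c * (a + ‖y‖ ^ 2) ^ q)
      ((c * q * 2 * (a + ‖x‖ ^ 2) ^ (q - 1)) • innerSL ℝ x) x := by
  have hs : a + ‖x‖ ^ 2 ≠ 0 := by positivity
  have h := (((hasStrictFDerivAt_norm_sq x).hasFDerivAt.const_add a).rpow_const
    (p := q) (Or.inl hs)).const_mul c
  refine h.congr_fderiv (ContinuousLinearMap.ext fun y => ?_)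
  simp
  ring

theorem hasFDerivAt_const_mul_log_add_norm_sq {F : Type*} [NormedAddCommGroup F]
    [InnerProductSpace ℝ F] {a : ℝ} (ha : 0 < a) (c : ℝ) (x : F) :
    HasFDerivAt (fun y : F => c * Real.log (a + ‖y‖ ^ 2))
      ((c * 2 * (a + ‖x‖ ^ 2)⁻¹) • innerSL ℝ x) x := by
  have hs : a + ‖x‖ ^ 2 ≠ 0 := by positivity
  have h := (((hasStrictFDerivAt_norm_sq x).hasFDerivAt.const_add a).log hs).const_mul c
  refine h.congr_fderiv (ContinuousLinearMap.ext fun y => ?_)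
  simp
  ring

theorem gradient_eq_smul_of_hasFDerivAt {F : Type*} [NormedAddCommGroup F]
    [InnerProductSpace ℝ F] [CompleteSpace F] {g : F → ℝ} {c : ℝ} {x y : F}
    (h : HasFDerivAt g (c • innerSL ℝ y) x) : gradient g x = c • y := by
  apply HasGradientAt.gradient
  rw [hasGradientAt_iff_hasFDerivAt]
  refine h.congr_fderiv (ContinuousLinearMap.ext fun z => ?_)
  simp

theorem lap_const_mul_rpow_add_norm_sq {n : ℕ} {a : ℝ} (ha : 0 < a) (c q : ℝ) (x : E n) :
    lap (fun y : E n => c * (a + ‖y‖ ^ 2) ^ q) x =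
      c * q * 2 * (n * (a + ‖x‖ ^ 2) ^ (q - 1) +
        2 * (q - 1) * (a + ‖x‖ ^ 2) ^ (q - 1 - 1) * ‖x‖ ^ 2) := by
  have h₁ : fderiv ℝ (fun y : E n => c * (a + ‖y‖ ^ 2) ^ q) =
      fun y => (c * q * 2 * (a + ‖y‖ ^ 2) ^ (q - 1)) • innerSL ℝ y :=
    funext fun y => (hasFDerivAt_const_mul_rpow_add_norm_sq ha c q y).fderiv
  have h₂ : HasFDerivAt (fun y : E n => (c * q * 2 * (a + ‖y‖ ^ 2) ^ (q - 1)) • innerSL ℝ y) _ x :=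
    (hasFDerivAt_const_mul_rpow_add_norm_sq ha (c * q * 2) (q - 1) x).smul
      (innerSL ℝ : E n →L[ℝ] E n →L[ℝ] ℝ).hasFDerivAt
  have h₃ : ∀ i : Fin n, iteratedFDeriv ℝ 2 (fun y : E n => c * (a + ‖y‖ ^ 2) ^ q) x
      ![EuclideanSpace.single i 1, EuclideanSpace.single i 1] =
      c * q * 2 * (a + ‖x‖ ^ 2) ^ (q - 1) +
        c * q * 2 * (q - 1) * 2 * (a + ‖x‖ ^ 2) ^ (q - 1 - 1) * x i ^ 2 := by
    intro i
    have h₄ : ∀ y : E n, innerSL ℝ y (EuclideanSpace.single i 1) = y i := fun y => by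
      rw [innerSL_apply_apply, EuclideanSpace.inner_single_right]
      simp
    have h₅ : ((innerSL ℝ : E n →L[ℝ] E n →L[ℝ] ℝ) (EuclideanSpace.single i 1))
        (EuclideanSpace.single i 1) = 1 := by
      rw [h₄]
      simp
    rw [iteratedFDeriv_two_apply, h₁, h₂.fderiv]
    change (c * q * 2 * (a + ‖x‖ ^ 2) ^ (q - 1)) *
        innerSL ℝ (EuclideanSpace.single i 1 : E n) (EuclideanSpace.single i 1) +
      (c * q * 2 * (q - 1) * 2 * (a + ‖x‖ ^ 2) ^ (q - 1 - 1) *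
        innerSL ℝ x (EuclideanSpace.single i 1)) * innerSL ℝ x (EuclideanSpace.single i 1) = _
    rw [h₅, h₄]
    ring
  unfold lap
  simp_rw [h₃]
  rw [Finset.sum_add_distrib, ← Finset.mul_sum (f := fun i => x i ^ 2),
    ← EuclideanSpace.real_norm_sq_eq]
  simp
  ring

open RealInnerProductSpace in
/-- the explicit function `u` solves the drift Lane–Emden equation
`Δu - ⟨∇f, ∇u⟩ + u^α = 0` on ℝⁿ, where `f(x) = Γ ln(μ² + |x|²)`. -/
theorem stmt14 (n : ℕ) (hn : 0 < n) (α μ : ℝ) (hα : 1 < α) (hμ : 0 < μ)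
    (Γ : ℝ) (hΓ : Γ = (1 / 2) * ((n : ℝ) - 2 - 4 / (α - 1)))
    (f u : E n → ℝ)
    (hf : f = fun x => Γ * Real.log (μ ^ 2 + ‖x‖ ^ 2))
    (hu : u = fun x => (Real.sqrt (4 * n / (α - 1)) * μ / (μ ^ 2 + ‖x‖ ^ 2)) ^ (2 / (α - 1))) :
    (∀ x, 0 < u x) ∧ ContDiff ℝ (⊤ : ℕ∞) u ∧
      ∀ x, lap u x - ⟪gradient f x, gradient u x⟫ + u x ^ α = 0 := by
  have hα' : 0 < α - 1 := sub_pos.mpr hα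
  have hn' : (0 : ℝ) < n := Nat.cast_pos.mpr hn
  have ha : 0 < μ ^ 2 := by positivity
  have hs : ∀ x : E n, 0 < μ ^ 2 + ‖x‖ ^ 2 := fun x => by positivity
  have hC : 0 < Real.sqrt (4 * n / (α - 1)) * μ :=
    mul_pos (Real.sqrt_pos.mpr (by positivity)) hμ
  have hC2 : (Real.sqrt (4 * n / (α - 1)) * μ) ^ 2 = 4 * n / (α - 1) * μ ^ 2 := by
    rw [mul_pow, Real.sq_sqrt (by positivity)]
  set C := Real.sqrt (4 * n / (α - 1)) * μ
  have hpos : ∀ x, 0 < u x := fun x => by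
    rw [hu]
    exact Real.rpow_pos_of_pos (div_pos hC (hs x)) _
  refine ⟨hpos, ?_, fun x => ?_⟩
  · rw [hu]
    refine ContDiff.rpow_const_of_ne ?_ fun x => (div_pos hC (hs x)).ne'
    exact contDiff_const.div (contDiff_const.add (contDiff_norm_sq ℝ)) fun x => (hs x).ne'
  · have hpow : u x ^ α = u x * (C ^ 2 / (μ ^ 2 + ‖x‖ ^ 2) ^ 2) := by
      have hd : 0 < C / (μ ^ 2 + ‖x‖ ^ 2) := div_pos hC (hs x)
      have he : 2 / (α - 1) * α = 2 / (α - 1) + (2 : ℕ) := by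
        push_cast
        field_simp
        ring
      simp only [hu]
      rw [← Real.rpow_mul hd.le, he, Real.rpow_add_natCast hd.ne', div_pow]
    have hu' : u = fun x => C ^ (2 / (α - 1)) * (μ ^ 2 + ‖x‖ ^ 2) ^ (-(2 / (α - 1))) := by
      rw [hu]
      funext y
      rw [Real.div_rpow hC.le (hs y).le, Real.rpow_neg (hs y).le, div_eq_mul_inv]
    rw [hpow, hC2, hu', hf, lap_const_mul_rpow_add_norm_sq ha,
      gradient_eq_smul_of_hasFDerivAt (hasFDerivAt_const_mul_log_add_norm_sq ha _ x),
      gradient_eq_smul_of_hasFDerivAt (hasFDerivAt_const_mul_rpow_add_norm_sq ha _ _ x),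
      inner_smul_left, inner_smul_right, real_inner_self_eq_norm_sq, hΓ]
    have hsx := (hs x).ne'
    simp only [conj_trivial, Real.rpow_sub_one hsx]
    generalize (μ ^ 2 + ‖x‖ ^ 2) ^ (-(2 / (α - 1))) = S
    generalize C ^ (2 / (α - 1)) = K
    field_simp
    ring
end

section
/- Let n be a positive integer, α > 1, μ > 0, and define u : ℝⁿ → ℝ by u(x) = ( √(4n/(α−1)) · μ/(μ² + |x|²) )^{2/(α−1)}. Then for every x ∈ ℝⁿ: |∇u(x)|²/u(x)² + u(x)^{α−1} = ( (16/(α−1)²)|x|² + (4n/(α−1))μ² ) / (μ² + |x|²)², and consequently sup_{x ∈ ℝⁿ} ( |∇u(x)|²/u(x)² + u(x)^{α−1} ) ≤ ( 4/(α−1)² + 4n/(α−1) ) / μ². -/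
open Set Metric

/-- The gradient of a power of the inverse of `m + ‖x‖ ^ 2`. -/
theorem hasGradientAt_div_add_norm_sq_rpow {F : Type*} [NormedAddCommGroup F]
    [InnerProductSpace ℝ F] [CompleteSpace F] {c m : ℝ} (hc : 0 < c) (hm : 0 < m) (p : ℝ) (x : F) :
    HasGradientAt (fun y : F => (c / (m + ‖y‖ ^ 2)) ^ p)
      ((-(2 * p / (m + ‖x‖ ^ 2)) * (c / (m + ‖x‖ ^ 2)) ^ p) • x) x := by
  have hpos : 0 < m + ‖x‖ ^ 2 := by positivity
  have hb : 0 < c / (m + ‖x‖ ^ 2) := div_pos hc hpos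
  have hsq : HasFDerivAt (fun y : F => ‖y‖ ^ 2) (2 • innerSL ℝ x) x :=
    (hasStrictFDerivAt_norm_sq x).hasFDerivAt
  have hdiv : HasDerivAt (fun t : ℝ => c / (m + t)) (-c / (m + ‖x‖ ^ 2) ^ 2) (‖x‖ ^ 2) := by
    simpa using (hasDerivAt_const (‖x‖ ^ 2) c).fun_div
      ((hasDerivAt_id (‖x‖ ^ 2)).const_add m) hpos.ne'
  have hcomp := (hdiv.rpow_const (p := p) (Or.inl hb.ne')).comp_hasFDerivAt x hsq
  rw [hasGradientAt_iff_hasFDerivAt]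
  refine hcomp.congr_fderiv ?_
  ext y
  simp only [smul_apply, innerSL_apply_apply,
    InnerProductSpace.toDual_apply_apply,
    real_inner_smul_left, smul_eq_mul, nsmul_eq_mul, Real.rpow_sub_one hb.ne']
  field_simp
  push_cast
  ring

/-- explicit value and bound for the quantity `|∇u|²/u² + u^{α-1}` for the
explicit solution `u` of the drift Lane–Emden equation. -/
theorem stmt15 (n : ℕ) (hn : 0 < n) (α μ : ℝ) (hα : 1 < α) (hμ : 0 < μ)
    (u : E n → ℝ)
    (hu : u = fun x => (Real.sqrt (4 * n / (α - 1)) * μ / (μ ^ 2 + ‖x‖ ^ 2)) ^ (2 / (α - 1))) :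
    (∀ x : E n,
      ‖gradient u x‖ ^ 2 / (u x) ^ 2 + u x ^ (α - 1)
        = ((16 / (α - 1) ^ 2) * ‖x‖ ^ 2 + (4 * n / (α - 1)) * μ ^ 2)
            / (μ ^ 2 + ‖x‖ ^ 2) ^ 2) ∧
    ∀ x : E n,
      ‖gradient u x‖ ^ 2 / (u x) ^ 2 + u x ^ (α - 1)
        ≤ (4 / (α - 1) ^ 2 + 4 * n / (α - 1)) / μ ^ 2 := by
  have hα' : 0 < α - 1 := sub_pos.2 hα
  have hn' : (0 : ℝ) < n := Nat.cast_pos.2 hn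
  have hk : 0 < 4 * (n : ℝ) / (α - 1) := by positivity
  have hc : 0 < Real.sqrt (4 * n / (α - 1)) * μ := by positivity
  have key : ∀ x : E n, ‖gradient u x‖ ^ 2 / (u x) ^ 2 + u x ^ (α - 1)
      = ((16 / (α - 1) ^ 2) * ‖x‖ ^ 2 + (4 * n / (α - 1)) * μ ^ 2) / (μ ^ 2 + ‖x‖ ^ 2) ^ 2 := by
    intro x
    have hpos : 0 < μ ^ 2 + ‖x‖ ^ 2 := by positivity
    have hb : 0 < Real.sqrt (4 * n / (α - 1)) * μ / (μ ^ 2 + ‖x‖ ^ 2) := div_pos hc hpos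
    have hgrad := (hasGradientAt_div_add_norm_sq_rpow hc (pow_pos hμ 2) (2 / (α - 1)) x).gradient
    have hpow : u x ^ (α - 1) = 4 * n / (α - 1) * μ ^ 2 / (μ ^ 2 + ‖x‖ ^ 2) ^ 2 := by
      simp only [hu]
      rw [← Real.rpow_mul hb.le, div_mul_cancel₀ _ hα'.ne', Real.rpow_two, div_pow, mul_pow,
        Real.sq_sqrt hk.le]
    have hux : 0 < u x := by
      simp only [hu]
      exact Real.rpow_pos_of_pos hb _
    have hg : gradient u x = (-(2 * (2 / (α - 1)) / (μ ^ 2 + ‖x‖ ^ 2)) * u x) • x := by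
      simpa only [hu] using hgrad
    rw [hpow, hg, norm_smul, mul_pow, Real.norm_eq_abs, sq_abs]
    field_simp
    ring
  refine ⟨key, fun x => ?_⟩
  have hpos : 0 < μ ^ 2 + ‖x‖ ^ 2 := by positivity
  rw [key x, div_le_div_iff₀ (by positivity) (by positivity)]
  have h₁ : 4 * (‖x‖ ^ 2 * μ ^ 2) ≤ (μ ^ 2 + ‖x‖ ^ 2) ^ 2 := by
    nlinarith [sq_nonneg (μ ^ 2 - ‖x‖ ^ 2)]
  have h₂ : μ ^ 2 * μ ^ 2 ≤ (μ ^ 2 + ‖x‖ ^ 2) ^ 2 := by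
    rw [← sq]
    gcongr
    exact le_add_of_nonneg_right (sq_nonneg _)
  calc (16 / (α - 1) ^ 2 * ‖x‖ ^ 2 + 4 * n / (α - 1) * μ ^ 2) * μ ^ 2
      = 4 / (α - 1) ^ 2 * (4 * (‖x‖ ^ 2 * μ ^ 2)) + 4 * n / (α - 1) * (μ ^ 2 * μ ^ 2) := by ring
    _ ≤ 4 / (α - 1) ^ 2 * (μ ^ 2 + ‖x‖ ^ 2) ^ 2
        + 4 * n / (α - 1) * (μ ^ 2 + ‖x‖ ^ 2) ^ 2 := by gcongr
    _ = (4 / (α - 1) ^ 2 + 4 * n / (α - 1)) * (μ ^ 2 + ‖x‖ ^ 2) ^ 2 := by ring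
end

section
/- Let n ≥ 2 be an integer, let N > n, Γ < 0 and μ > 0 be real numbers, and set γ = 1 + Γ/(N−n). For x, v ∈ ℝⁿ define the quadratic form Q_x(v) = ( Γ/(μ² + |x|²)² ) · ( 2(μ² + |x|²)|v|² − 4γ⟨x,v⟩² ). Define K as follows: K = −2Γ/μ² if N − n ≥ −(2/3)Γ, and K = Γ(N−n+2Γ)²/( 4(N−n)(N−n+Γ)μ² ) if N − n ≤ −(2/3)Γ. Then Q_x(v) ≥ −K|v|² for all x, v ∈ ℝⁿ, and there exist x ∈ ℝⁿ and v ∈ ℝⁿ with v ≠ 0 such that Q_x(v) = −K|v|²; that is, −K is the infimum over x of the smallest eigenvalue of the symmetric matrix representing Q_x. -/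
open Set Metric

open RealInnerProductSpace in
/-- `-K` is the sharp lower bound of the N-Bakry–Émery Ricci form
`Q_x(v)` of the weighted space `(ℝⁿ, e^{-f}dx)` with `f(x) = Γ ln(μ² + |x|²)`. -/
theorem stmt16 (n : ℕ) (hn : 2 ≤ n) (N Γ μ K : ℝ)
    (hN : (n : ℝ) < N) (hΓ : Γ < 0) (hμ : 0 < μ)
    (hK1 : -(2 / 3) * Γ ≤ N - n → K = -2 * Γ / μ ^ 2)
    (hK2 : N - n ≤ -(2 / 3) * Γ →
      K = Γ * (N - n + 2 * Γ) ^ 2 / (4 * (N - n) * (N - n + Γ) * μ ^ 2))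
    (γ : ℝ) (hγ : γ = 1 + Γ / (N - n))
    (Q : E n → E n → ℝ)
    (hQ : Q = fun x v => (Γ / (μ ^ 2 + ‖x‖ ^ 2) ^ 2) *
      (2 * (μ ^ 2 + ‖x‖ ^ 2) * ‖v‖ ^ 2 - 4 * γ * ⟪x, v⟫ ^ 2)) :
    (∀ x v : E n, -K * ‖v‖ ^ 2 ≤ Q x v) ∧
      ∃ x v : E n, v ≠ 0 ∧ Q x v = -K * ‖v‖ ^ 2 := by
  have hm : 0 < N - n := sub_pos.mpr hN
  obtain ⟨c, hc⟩ : ∃ c, c = -γ := ⟨_, rfl⟩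
  have hγc : γ = -c := by rw [hc, neg_neg]
  have hΓc : Γ = -(1 + c) * (N - n) := by
    rw [hc, hγ]
    field_simp
    ring
  have hμ2 : 0 < μ ^ 2 := by positivity
  have hcs : ∀ x v : E n, ⟪x, v⟫ ^ 2 ≤ ‖x‖ ^ 2 * ‖v‖ ^ 2 := fun x v => by
    rw [← mul_pow, ← sq_abs]
    exact pow_le_pow_left₀ (abs_nonneg _) (abs_real_inner_le_norm x v) 2
  let e : E n := EuclideanSpace.single ⟨0, by omega⟩ 1
  have he : ‖e‖ = 1 := by simp [e]
  have he0 : e ≠ 0 := norm_ne_zero_iff.mp (by rw [he]; exact one_ne_zero)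
  subst hQ
  generalize μ ^ 2 = a at *
  rcases le_total (-(2 / 3) * Γ) (N - n) with h | h
  · have hK := hK1 h
    have hc2 : c ≤ 1 / 2 := by
      by_contra! hlt
      nlinarith [mul_pos (sub_pos.mpr hlt) hm]
    refine ⟨fun x v => ?_, 0, e, he0, ?_⟩
    · have hp := hcs x v
      have hp0 := sq_nonneg ⟪x, v⟫
      have hV := sq_nonneg ‖v‖
      have ht := sq_nonneg ‖x‖
      simp only [hK, hγc]
      generalize ‖x‖ ^ 2 = t at *
      generalize ‖v‖ ^ 2 = V at *
      generalize ⟪x, v⟫ ^ 2 = p at *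
      have hs : 0 < a + t := by positivity
      have key : a * (2 * (a + t) * V + 4 * c * p) ≤ 2 * V * (a + t) ^ 2 := by
        have h1 : c * p ≤ 1 / 2 * (t * V) := by nlinarith
        have h2 := mul_le_mul_of_nonneg_left h1 hμ2.le
        have h3 : 0 ≤ t ^ 2 * V := by positivity
        nlinarith
      rw [← sub_nonneg]
      have : Γ / (a + t) ^ 2 * (2 * (a + t) * V - 4 * -c * p) - -(-2 * Γ / a) * V =
          (-Γ) * (2 * V * (a + t) ^ 2 - a * (2 * (a + t) * V + 4 * c * p)) /
            (a * (a + t) ^ 2) := by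
        field_simp
        ring
      rw [this]
      exact div_nonneg (mul_nonneg (by linarith) (sub_nonneg.mpr key)) (by positivity)
    · simp only [hK, he, norm_zero, inner_zero_left]
      field_simp
      ring
  · have hc2 : 1 / 2 ≤ c := by
      by_contra! hlt
      nlinarith [mul_pos (sub_pos.mpr hlt) hm]
    have hc0 : 0 < c := by linarith
    have hK : K = -Γ * (1 + 2 * c) ^ 2 / (4 * c * a) := by
      rw [hK2 h]
      have h1 : N - n + 2 * Γ = -(1 + 2 * c) * (N - n) := by rw [hΓc]; ring
      have h2 : N - n + Γ = -c * (N - n) := by rw [hΓc]; ring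
      rw [h1, h2]
      field_simp
    refine ⟨fun x v => ?_, √(a * (2 * c - 1) / (1 + 2 * c)) • e, e, he0, ?_⟩
    · have hp := hcs x v
      have hV := sq_nonneg ‖v‖
      have ht := sq_nonneg ‖x‖
      simp only [hK, hγc]
      generalize ‖x‖ ^ 2 = t at *
      generalize ‖v‖ ^ 2 = V at *
      generalize ⟪x, v⟫ ^ 2 = p at *
      have hs : 0 < a + t := by positivity
      have key : 4 * c * a * (2 * (a + t) * V + 4 * c * p) ≤
          (1 + 2 * c) ^ 2 * (a + t) ^ 2 * V := by
        have h1 : 16 * c ^ 2 * a * p ≤ 16 * c ^ 2 * a * (t * V) :=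
          mul_le_mul_of_nonneg_left hp (by positivity)
        have h2 := mul_nonneg (sq_nonneg ((1 + 2 * c) * (a + t) - 4 * c * a)) hV
        linarith
      rw [← sub_nonneg]
      have : Γ / (a + t) ^ 2 * (2 * (a + t) * V - 4 * -c * p) -
            -(-Γ * (1 + 2 * c) ^ 2 / (4 * c * a)) * V =
          (-Γ) * ((1 + 2 * c) ^ 2 * (a + t) ^ 2 * V -
            4 * c * a * (2 * (a + t) * V + 4 * c * p)) / (4 * c * a * (a + t) ^ 2) := by
        field_simp
        ring
      rw [this]
      exact div_nonneg (mul_nonneg (by linarith) (sub_nonneg.mpr key)) (by positivity)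
    · have ht : 0 ≤ a * (2 * c - 1) / (1 + 2 * c) :=
        div_nonneg (mul_nonneg hμ2.le (by linarith)) (by linarith)
      have hs : a + a * (2 * c - 1) / (1 + 2 * c) = 4 * c * a / (1 + 2 * c) := by
        field_simp
        ring
      simp only [hK, hγc, norm_smul, real_inner_smul_left, real_inner_self_eq_norm_sq, he,
        Real.norm_eq_abs, mul_one, one_pow, sq_abs, Real.sq_sqrt ht, hs]
      field_simp
      ring
end

section
/- Let N ≥ 1, Λ and Π be real numbers, and assume Λ < (N+3)/(N−1) in case N > 1 (no restriction on Λ in case N = 1). Then there exist real numbers β > 0, d ∈ (0,1) and l > 0 such that: (i) (2/N)(1 + 1/β)² − 2 − l ≥ 0; (ii) (2/N)β² + d(1−Λ) − l ≥ 0; and (iii) 2·√( ((2/N)(1+1/β)² − 2 − l) · ((2/N)β² + d(1−Λ) − l) ) + (4/N)(1+β) + (2 + 2d/β)(1−Λ) + (d/β²)Π > 0. -/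
open Filter Topology in
/-- If the coercivity conditions hold strictly for some `β` in the limit `d = l = 0`, then they
persist for small positive `d` and `l`. -/
theorem exists_parameters_of_limit_pos {N Λ Pi β : ℝ} (hβ : 0 < β)
    (hA : 0 < (2 / N) * (1 + 1 / β) ^ 2 - 2) (hB : 0 < (2 / N) * β ^ 2)
    (hS : 0 < 2 * Real.sqrt (((2 / N) * (1 + 1 / β) ^ 2 - 2) * ((2 / N) * β ^ 2))
      + (4 / N) * (1 + β) + 2 * (1 - Λ)) :
    ∃ β d l : ℝ, 0 < β ∧ 0 < d ∧ d < 1 ∧ 0 < l ∧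
      0 ≤ (2 / N) * (1 + 1 / β) ^ 2 - 2 - l ∧
      0 ≤ (2 / N) * β ^ 2 + d * (1 - Λ) - l ∧
      0 < 2 * Real.sqrt (((2 / N) * (1 + 1 / β) ^ 2 - 2 - l) *
            ((2 / N) * β ^ 2 + d * (1 - Λ) - l))
          + (4 / N) * (1 + β) + (2 + 2 * d / β) * (1 - Λ) + (d / β ^ 2) * Pi := by
  have eventually_pos (f : ℝ → ℝ) (hf : Continuous f) (h0 : 0 < f 0) :
      ∀ᶠ t in 𝓝[>] (0 : ℝ), 0 < f t :=
    (hf.continuousAt.eventually (lt_mem_nhds h0)).filter_mono nhdsWithin_le_nhds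
  have h1 := eventually_pos (fun t ↦ 1 - t) (by fun_prop) (by norm_num)
  have h2 := eventually_pos (fun t ↦ (2 / N) * (1 + 1 / β) ^ 2 - 2 - t) (by fun_prop)
    (by simpa only [sub_zero] using hA)
  have h3 := eventually_pos (fun t ↦ (2 / N) * β ^ 2 + t * (1 - Λ) - t) (by fun_prop)
    (by simpa only [zero_mul, add_zero, sub_zero] using hB)
  have h4 := eventually_pos
    (fun t ↦ 2 * Real.sqrt (((2 / N) * (1 + 1 / β) ^ 2 - 2 - t) *
            ((2 / N) * β ^ 2 + t * (1 - Λ) - t))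
          + (4 / N) * (1 + β) + (2 + 2 * t / β) * (1 - Λ) + (t / β ^ 2) * Pi) (by fun_prop)
    (by simpa only [zero_mul, mul_zero, zero_div, add_zero, sub_zero] using hS)
  obtain ⟨t, ht1, ht2, ht3, ht4, ht0⟩ :=
    (h1.and <| h2.and <| h3.and <| h4.and self_mem_nhdsWithin).exists
  exact ⟨β, t, t, hβ, ht0, sub_pos.mp ht1, ht0, ht2.le, ht3.le, ht4⟩


/-- the algebraic content of Lemma 4.1: existence of parameters
`β > 0`, `d ∈ (0,1)`, `l > 0` making the Bochner quadratic form coercive. -/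
theorem stmt17 (N Λ Pi : ℝ) (hN : 1 ≤ N) (hΛ : 1 < N → Λ < (N + 3) / (N - 1)) :
    ∃ β d l : ℝ, 0 < β ∧ 0 < d ∧ d < 1 ∧ 0 < l ∧
      0 ≤ (2 / N) * (1 + 1 / β) ^ 2 - 2 - l ∧
      0 ≤ (2 / N) * β ^ 2 + d * (1 - Λ) - l ∧
      0 < 2 * Real.sqrt (((2 / N) * (1 + 1 / β) ^ 2 - 2 - l) *
            ((2 / N) * β ^ 2 + d * (1 - Λ) - l))
          + (4 / N) * (1 + β) + (2 + 2 * d / β) * (1 - Λ) + (d / β ^ 2) * Pi := by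
  rcases hN.eq_or_lt with rfl | hN1
  · have hβ : 0 < 1 + |Λ| := by positivity
    refine exists_parameters_of_limit_pos hβ ?_ (by positivity) ?_
    · have : 0 < 1 / (1 + |Λ|) := by positivity
      nlinarith
    · have := Real.sqrt_nonneg
        (((2 / 1) * (1 + 1 / (1 + |Λ|)) ^ 2 - 2) * ((2 / 1) * (1 + |Λ|) ^ 2))
      linarith [le_abs_self Λ, abs_nonneg Λ]
  · have hN0 : 0 < N := by linarith
    have hN2 : 0 < N - 1 := sub_pos.mpr hN1
    have hA : (2 / N) * (1 + 1 / (2 / (N - 1))) ^ 2 - 2 = (N - 1) ^ 2 / (2 * N) := by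
      field_simp
      ring
    have hsqrt : Real.sqrt ((N - 1) ^ 2 / (2 * N) * ((2 / N) * (2 / (N - 1)) ^ 2)) = 2 / N := by
      rw [show (N - 1) ^ 2 / (2 * N) * ((2 / N) * (2 / (N - 1)) ^ 2) = (2 / N) ^ 2 by
        field_simp]
      exact Real.sqrt_sq (by positivity)
    refine exists_parameters_of_limit_pos (β := 2 / (N - 1)) (by positivity) ?_ (by positivity) ?_
    · rw [hA]
      positivity
    · rw [hA, hsqrt]
      have hsum : 2 * (2 / N) + (4 / N) * (1 + 2 / (N - 1)) + 2 * (1 - Λ)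
          = 2 * ((N + 3) / (N - 1) - Λ) := by
        field_simp
        ring
      rw [hsum]
      linarith [hΛ hN1]
end
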